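/- arXiv:1509.08803 — 8 statements merged into one kernel-verified Lean document; each statement's English description precedes it below -/
import Mathlib

section
/- Let p > 1 and λ > 0 be real numbers, and let v : ℝ → ℝ be a twice continuously differentiable function such that 0 < v(x) ≤ 1 for all x ∈ ℝ, v''(x) + λ p v(x)^{p−1} v'(x) + v(x)^p − v(x) = 0 for all x ∈ ℝ, and lim_{x→−∞} v(x) = 0. Then lim_{x→−∞} v'(x) = 0. -/
open Real Filter Topology

theorem deriv_tendsto_zero_atBot
    (p lam : ℝ) (hp : 1 < p) (hlam : 0 < lam)
    (v : ℝ → ℝ) (hv : ContDiff ℝ 2 v)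
    (hpos : ∀ x, 0 < v x) (hle : ∀ x, v x ≤ 1)
    (hode : ∀ x, deriv (deriv v) x + lam * p * v x ^ (p - 1) * deriv v x
      + v x ^ p - v x = 0)
    (hlim : Tendsto v atBot (𝓝 0)) :
    Tendsto (deriv v) atBot (𝓝 0) := by
  have hd : Differentiable ℝ v := hv.differentiable (by norm_num)
  have hd2 : Differentiable ℝ (deriv v) :=
    ((contDiff_succ_iff_deriv (n := 1)).1 hv).2.2.differentiable (by norm_num)
  have hpow : ∀ x, v x ^ p ≤ v x := fun x => by
    have := Real.rpow_le_rpow_of_exponent_ge (hpos x) (hle x) hp.le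
    simpa using this
  have hpow0 : ∀ x, 0 < v x ^ p := fun x => Real.rpow_pos_of_pos (hpos x) p
  have hw : ∀ x, HasDerivAt (fun x => deriv v x + lam * v x ^ p) (v x - v x ^ p) x := fun x => by
    have h1 := (hd x).hasDerivAt.rpow_const (p := p) (Or.inl (hpos x).ne')
    have h2 := (hd2 x).hasDerivAt.add (h1.const_mul lam)
    refine h2.congr_deriv ?_
    linarith [hode x]
  have hmono : Monotone (fun x => deriv v x + lam * v x ^ p) :=
    monotone_of_hasDerivAt_nonneg hw (fun x => by simpa using hpow x)
  have hmvt : ∀ x, ∃ y ∈ Set.Ioo x (x + 1), deriv v y = v (x + 1) - v x := fun x => by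
    obtain ⟨y, hy, h⟩ := exists_deriv_eq_slope v (lt_add_one x) hd.continuous.continuousOn
      hd.differentiableOn
    exact ⟨y, hy, by simpa using h⟩
  rw [Metric.tendsto_nhds]
  intro ε hε
  have hδ : 0 < ε / (1 + 2 * lam) := by positivity
  obtain ⟨N, hN⟩ := eventually_atBot.1 (hlim.eventually (gt_mem_nhds hδ))
  filter_upwards [eventually_le_atBot (N - 1)] with x hx
  set δ := ε / (1 + 2 * lam) with hδdef
  have hεδ : ε = δ + 2 * (lam * δ) := by rw [hδdef]; field_simp
  have hs : ∀ y ≤ N, lam * v y ^ p < lam * δ := fun y hy =>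
    mul_lt_mul_of_pos_left ((hpow y).trans_lt (hN y hy)) hlam
  have hs0 : ∀ y, 0 < lam * v y ^ p := fun y => mul_pos hlam (hpow0 y)
  obtain ⟨a, ha, ha'⟩ := hmvt (x - 1)
  obtain ⟨b, hb, hb'⟩ := hmvt x
  rw [sub_add_cancel] at ha ha'
  have h1 := hmono ha.2.le
  have h2 := hmono hb.1.le
  simp only at h1 h2
  have hlδ : 0 < lam * δ := by positivity
  rw [Real.dist_eq, sub_zero, abs_lt]
  constructor
  · linarith [hs x (by linarith), hs0 a, hN (x - 1) (by linarith), hpos x]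
  · linarith [hs b (by linarith [hb.2]), hs0 x, hN (x + 1) (by linarith), hpos x]
end

section
/- In the merged traveling-wave configuration, for every τ ∈ ℝ there exists a unique x(τ) ∈ ℝ with u₁(x(τ),τ) = u₂(x(τ),τ), and the intersection point satisfies lim_{τ→−∞} [ x(τ) − ((γ_λ − γ_{λ'})/p) τ ] = (1/(γ_λ + γ_{λ'})) ( ln(C_λ/C_{λ'}) + h' γ_{λ'} − h γ_λ ). -/
open Real Filter Topology MeasureTheory

/-- A traveling-wave profile with speed `lam` for the cylindrical Yamabe-flow
equation `(u^p)_τ = u_{xx} + u^p - u`: it is `C²`, takes values in `(0,1]`,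
is strictly increasing, solves `v'' + λ p v^{p-1} v' + v^p - v = 0`,
tends to `0` at `-∞` and to `1` at `+∞`. -/
def IsTWProfile (p lam : ℝ) (v : ℝ → ℝ) : Prop :=
  ContDiff ℝ 2 v ∧ (∀ x, 0 < v x) ∧ (∀ x, v x ≤ 1) ∧ (∀ x, 0 < deriv v x) ∧
  (∀ x, deriv (deriv v) x + lam * p * v x ^ (p - 1) * deriv v x + v x ^ p - v x = 0) ∧
  Filter.Tendsto v Filter.atBot (nhds 0) ∧ Filter.Tendsto v Filter.atTop (nhds 1)

/-- The profile `v` has exponential asymptotics at `+∞` with rate `gam` and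
constant `C`: `v(x) = 1 - C e^{-γ x} + o(e^{-γ x})` where `γ` is a root of the
characteristic equation `γ² - λ p γ + (p-1) = 0`. -/
def HasExpAsym (p lam gam C : ℝ) (v : ℝ → ℝ) : Prop :=
  0 < gam ∧ 0 < C ∧ gam ^ 2 - lam * p * gam + (p - 1) = 0 ∧
  Filter.Tendsto (fun x => Real.exp (gam * x) * (1 - v x)) Filter.atTop (nhds C)

lemma tw_strictMono {p lam : ℝ} {v : ℝ → ℝ} (hv : IsTWProfile p lam v) : StrictMono v :=
  strictMono_of_deriv_pos hv.2.2.2.1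

lemma tw_lt_one {p lam : ℝ} {v : ℝ → ℝ} (hv : IsTWProfile p lam v) (x : ℝ) : v x < 1 :=
  lt_of_lt_of_le (tw_strictMono hv (lt_add_one x)) (hv.2.2.1 _)

lemma tw_arg_tendsto {p lam lam' : ℝ} {v w : ℝ → ℝ} (hv : IsTWProfile p lam v)
    (hw : IsTWProfile p lam' w) {a b : ℝ → ℝ} (hab : ∀ τ, v (a τ) = w (b τ))
    (hsum : Tendsto (fun τ => a τ + b τ) atBot atTop) : Tendsto a atBot atTop := by
  rw [tendsto_atTop]
  intro M
  obtain ⟨B, hB⟩ := (hw.2.2.2.2.2.2.eventually (lt_mem_nhds (tw_lt_one hv M))).exists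
  filter_upwards [hsum.eventually_gt_atTop (M + B)] with τ hτ
  by_contra hlt
  push Not at hlt
  have h1 := tw_strictMono hv hlt
  rw [hab τ] at h1
  have h2 := (tw_strictMono hw).lt_iff_lt.mp (h1.trans hB)
  linarith

lemma tw_log_tendsto {p lam gam C : ℝ} {v : ℝ → ℝ} (hv : IsTWProfile p lam v)
    (hC : HasExpAsym p lam gam C v) :
    Tendsto (fun x => gam * x + Real.log (1 - v x)) atTop (𝓝 (Real.log C)) := by
  have h1 := hC.2.2.2.log hC.2.1.ne'
  refine h1.congr fun x => ?_
  have := tw_lt_one hv x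
  rw [Real.log_mul (Real.exp_pos _).ne' (by linarith), Real.log_exp]

theorem intersection_point_asymptotics
    (p lam lam' h h' gam gam' C C' : ℝ)
    (hp : 1 < p) (hlam : 1 ≤ lam) (hlam' : 1 ≤ lam')
    (vl vl' : ℝ → ℝ)
    (hprof : IsTWProfile p lam vl) (hprof' : IsTWProfile p lam' vl')
    (hasym : HasExpAsym p lam gam C vl) (hasym' : HasExpAsym p lam' gam' C' vl') :
    (∀ τ : ℝ, ∃! x : ℝ, vl (x - lam * τ + h) = vl' (-x - lam' * τ + h')) ∧
    (∀ X : ℝ → ℝ, (∀ τ, vl (X τ - lam * τ + h) = vl' (-(X τ) - lam' * τ + h')) →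
      Tendsto (fun τ => X τ - ((gam - gam') / p) * τ) atBot
        (𝓝 ((1 / (gam + gam')) *
          (Real.log (C / C') + h' * gam' - h * gam)))) := by
  refine ⟨fun τ => ?_, fun X hX => ?_⟩
  · have hm := tw_strictMono hprof
    have hm' := tw_strictMono hprof'
    have hc : Continuous vl := hprof.1.continuous
    have hc' : Continuous vl' := hprof'.1.continuous
    have hf : StrictMono (fun x => vl (x - lam * τ + h) - vl' (-x - lam' * τ + h')) := by
      intro x y hxy
      have h1 : vl (x - lam * τ + h) < vl (y - lam * τ + h) := hm (by linarith)
      have h2 : vl' (-y - lam' * τ + h') < vl' (-x - lam' * τ + h') := hm' (by linarith)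
      show vl (x - lam * τ + h) - vl' (-x - lam' * τ + h') <
        vl (y - lam * τ + h) - vl' (-y - lam' * τ + h')
      linarith
    have hcf : Continuous (fun x => vl (x - lam * τ + h) - vl' (-x - lam' * τ + h')) := by
      fun_prop
    have a1 : Tendsto (fun x : ℝ => x - lam * τ + h) atTop atTop :=
      tendsto_atTop_add_const_right _ _ (tendsto_atTop_add_const_right _ _ tendsto_id)
    have a2 : Tendsto (fun x : ℝ => x - lam * τ + h) atBot atBot :=
      tendsto_atBot_add_const_right _ _ (tendsto_atBot_add_const_right _ _ tendsto_id)
    have a3 : Tendsto (fun x : ℝ => -x - lam' * τ + h') atTop atBot :=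
      tendsto_atBot_add_const_right _ _
        (tendsto_atBot_add_const_right _ _ tendsto_neg_atTop_atBot)
    have a4 : Tendsto (fun x : ℝ => -x - lam' * τ + h') atBot atTop :=
      tendsto_atTop_add_const_right _ _
        (tendsto_atTop_add_const_right _ _ tendsto_neg_atBot_atTop)
    have t1 := (hprof.2.2.2.2.2.2.comp a1).sub (hprof'.2.2.2.2.2.1.comp a3)
    have t2 := (hprof.2.2.2.2.2.1.comp a2).sub (hprof'.2.2.2.2.2.2.comp a4)
    obtain ⟨y, hy⟩ := (t1.eventually (lt_mem_nhds (show (0:ℝ) < 1 - 0 by norm_num))).exists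
    obtain ⟨z, hz⟩ := (t2.eventually (gt_mem_nhds (show (0:ℝ) - 1 < 0 by norm_num))).exists
    obtain ⟨x, hx⟩ := mem_range_of_exists_le_of_exists_ge hcf ⟨z, hz.le⟩ ⟨y, hy.le⟩
    refine ⟨x, sub_eq_zero.mp hx, fun w hw => hf.injective ?_⟩
    exact (sub_eq_zero.mpr hw).trans hx.symm
  · have hsum : Tendsto (fun τ => (X τ - lam * τ + h) + (-(X τ) - lam' * τ + h')) atBot atTop := by
      have h1 : Tendsto (fun τ : ℝ => (-(lam + lam')) * τ + (h + h')) atBot atTop :=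
        tendsto_atTop_add_const_right _ _
          (tendsto_id.const_mul_atBot_of_neg (by linarith))
      exact h1.congr fun τ => by ring
    have ha := tw_arg_tendsto hprof hprof' hX hsum
    have hb := tw_arg_tendsto hprof' hprof (fun τ => (hX τ).symm)
      (hsum.congr fun τ => add_comm _ _)
    have l1 := (tw_log_tendsto hprof hasym).comp ha
    have l2 := (tw_log_tendsto hprof' hasym').comp hb
    obtain ⟨g0, C0, e1, -⟩ := hasym
    obtain ⟨g0', C0', e2, -⟩ := hasym'
    have l3 := (((l1.sub l2).add_const (h' * gam' - h * gam))).const_mul (1 / (gam + gam'))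
    rw [Real.log_div C0.ne' C0'.ne', add_sub_assoc]
    refine l3.congr fun τ => ?_
    simp only [Function.comp, hX τ]
    have hg : gam + gam' ≠ 0 := by positivity
    have hp0 : p ≠ 0 := by positivity
    field_simp
    linear_combination τ * (e1 - e2)
end

section
/- In the merged traveling-wave configuration, assume additionally there is M > 0 with v_λ(x) ≤ M e^x and v_{λ'}(x) ≤ M e^x for all x ≤ 0. Set v(x,τ) = min(u₁(x,τ), u₂(x,τ)) and let x(τ) be the unique intersection point with u₁(x(τ),τ) = u₂(x(τ),τ). Then for every τ ∈ ℝ the functions x ↦ v(x,τ) and x ↦ v(x,τ)^p are Lebesgue integrable on ℝ, the function F(τ) := ∫_ℝ v(x,τ)^p dx is differentiable, and F'(τ) = ∫_ℝ v(x,τ)^p dx − ∫_ℝ v(x,τ) dx + v_λ'(x(τ) − λτ + h) + v_{λ'}'(−x(τ) − λ'τ + h'). -/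
open Real Filter Topology MeasureTheory

open Set

/-- bounded by exponential => integrable on half lines -/
lemma aux_int {p lam : ℝ} {w : ℝ → ℝ} {M : ℝ} (hw : IsTWProfile p lam w)
    (hb : ∀ x ≤ (0:ℝ), w x ≤ M * Real.exp x) (a : ℝ) : IntegrableOn w (Iic a) := by
  obtain ⟨hc, hpos, -⟩ := hw
  have hcont : Continuous w := hc.continuous
  have h0 : IntegrableOn w (Iic 0) := by
    refine Integrable.mono' ((integrableOn_exp_Iic 0).const_mul M)
      hcont.aestronglyMeasurable ?_
    refine (ae_restrict_iff' measurableSet_Iic).2 (ae_of_all _ fun x hx => ?_)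
    rw [Real.norm_of_nonneg (hpos x).le]
    exact hb x hx
  have h1 : IntegrableOn w (Icc 0 a) := hcont.integrableOn_Icc
  refine (h0.union h1).mono_set fun x hx => ?_
  rcases le_total x 0 with h | h
  · exact Or.inl h
  · exact Or.inr ⟨h, hx⟩

lemma aux_cont {p lam : ℝ} {w : ℝ → ℝ} (hp : 1 < p) (hw : IsTWProfile p lam w) :
    Continuous fun x => w x ^ p :=
  hw.1.continuous.rpow_const fun _ => Or.inr (by linarith)

lemma aux_le {p lam : ℝ} {w : ℝ → ℝ} (hp : 1 < p) (hw : IsTWProfile p lam w) (x : ℝ) :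
    w x ^ p ≤ w x := by
  simpa using Real.rpow_le_rpow_of_exponent_ge (hw.2.1 x) (hw.2.2.1 x) hp.le

lemma aux_intp {p lam : ℝ} {w : ℝ → ℝ} {M : ℝ} (hp : 1 < p) (hw : IsTWProfile p lam w)
    (hb : ∀ x ≤ (0:ℝ), w x ≤ M * Real.exp x) (a : ℝ) :
    IntegrableOn (fun x => w x ^ p) (Iic a) := by
  refine Integrable.mono' (aux_int hw hb a) (aux_cont hp hw).aestronglyMeasurable ?_
  refine ae_of_all _ fun x => ?_
  rw [Real.norm_of_nonneg (Real.rpow_nonneg (hw.2.1 x).le _)]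
  exact aux_le hp hw x

lemma aux_hasDeriv {f : ℝ → ℝ} (hf : Continuous f) (hi : ∀ a, IntegrableOn f (Iic a)) (a : ℝ) :
    HasDerivAt (fun y => ∫ x in Iic y, f x) (f a) a := by
  have h1 : (fun y => ∫ x in Iic y, f x) = fun y => (∫ x in (0:ℝ)..y, f x) + ∫ x in Iic 0, f x := by
    funext y
    rw [← intervalIntegral.integral_Iic_sub_Iic (hi 0) (hi y)]
    ring
  rw [h1]
  exact (intervalIntegral.integral_hasDerivAt_right (hf.intervalIntegrable _ _)
    hf.stronglyMeasurable.stronglyMeasurableAtFilter hf.continuousAt).add_const _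

lemma aux_Q {p lam : ℝ} {w : ℝ → ℝ} {M : ℝ} (hp : 1 < p) (hlam : 1 ≤ lam)
    (hw : IsTWProfile p lam w)
    (hb : ∀ x ≤ (0:ℝ), w x ≤ M * Real.exp x) (a : ℝ) :
    (∫ x in Iic a, w x) - (∫ x in Iic a, w x ^ p) = deriv w a + lam * w a ^ p := by
  have hw' := hw
  obtain ⟨hc, hpos, hle, hd, hode, hbot, -⟩ := hw'
  have hdw : ∀ x, HasDerivAt w (deriv w x) x := fun x =>
    (hc.differentiable (by norm_num) x).hasDerivAt
  have hc1 : ContDiff ℝ 1 (deriv w) := by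
    have h2 : ContDiff ℝ (1 + 1) w := by simpa [one_add_one_eq_two] using hc
    exact (contDiff_succ_iff_deriv.1 h2).2.2
  have hddw : ∀ x, HasDerivAt (deriv w) (deriv (deriv w) x) x := fun x =>
    (hc1.differentiable (by norm_num) x).hasDerivAt
  have hQ : ∀ x, HasDerivAt (fun y => deriv w y + lam * w y ^ p) (w x - w x ^ p) x := by
    intro x
    have h1 := (hddw x).add (((hdw x).rpow_const (p := p) (Or.inl (hpos x).ne')).const_mul lam)
    refine h1.congr_deriv ?_
    have := hode x
    linarith
  have hmono : Monotone (fun y => deriv w y + lam * w y ^ p) := by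
    refine monotone_of_deriv_nonneg (fun x => (hQ x).differentiableAt) fun x => ?_
    rw [(hQ x).deriv]
    linarith [aux_le hp hw x]
  have hwm : StrictMono w := strictMono_of_deriv_pos hd
  have htw : Tendsto (fun x => w (x + 1)) atBot (𝓝 0) :=
    hbot.comp (tendsto_atBot_add_const_right _ 1 tendsto_id)
  have hlim : Tendsto (fun y => deriv w y + lam * w y ^ p) atBot (𝓝 0) := by
    have hup : Tendsto (fun x => w (x + 1) + lam * w (x + 1) ) atBot (𝓝 0) := by
      simpa using htw.add (htw.const_mul lam)
    refine squeeze_zero (fun x => ?_) (fun x => ?_) hup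
    · have := hd x
      have := Real.rpow_nonneg (hpos x).le p
      nlinarith
    · obtain ⟨c, hc, hce⟩ := exists_deriv_eq_slope w (show x < x + 1 by linarith)
        hc.continuous.continuousOn (hc.differentiable (by norm_num)).differentiableOn
      have h1 := hmono hc.1.le
      have h2 := aux_le hp hw c
      have h3 := hwm hc.2
      have h4 := hpos x
      simp only [add_sub_cancel_left, div_one] at hce
      simp only at h1
      rw [hce] at h1
      nlinarith
  rw [← integral_sub (aux_int hw hb a) (aux_intp hp hw hb a),
    integral_Iic_of_hasDerivAt_of_tendsto' (fun x _ => hQ x)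
      ((aux_int hw hb a).sub (aux_intp hp hw hb a)) hlim]
  ring

/-- splitting a two sided function -/
lemma aux_split {f g k : ℝ → ℝ} {s t y : ℝ} 
    (hf : IntegrableOn f (Iic (y + s))) (hg : IntegrableOn g (Iic (t - y)))
    (h1 : ∀ x ≤ y, k x = f (x + s)) (h2 : ∀ x, y < x → k x = g (t - x)) :
    Integrable k ∧ ∫ x, k x = (∫ x in Iic (y + s), f x) + ∫ x in Iic (t - y), g x := by
  have hg' : IntegrableOn g (Iio (t - y)) := hg.mono_set Iio_subset_Iic_self
  have hk : k = fun x => (Iic (y + s)).indicator f (x + s) + (Iio (t - y)).indicator g (t - x) := by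
    funext x
    rcases le_or_gt x y with h | h
    · rw [indicator_of_mem (by simpa using h), indicator_of_notMem (by simpa using h), h1 x h,
        add_zero]
    · rw [indicator_of_notMem (by simpa using h), indicator_of_mem (by simpa using h), h2 x h,
        zero_add]
  have i1 := (hf.integrable_indicator measurableSet_Iic).comp_add_right s
  have i2 := (hg'.integrable_indicator measurableSet_Iio).comp_sub_left t
  rw [hk]
  refine ⟨i1.add i2, ?_⟩
  rw [integral_add i1 i2, integral_add_right_eq_self (fun x => (Iic (y + s)).indicator f x),
    integral_sub_left_eq_self (fun x => (Iio (t - y)).indicator g x),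
    integral_indicator measurableSet_Iic, integral_indicator measurableSet_Iio,
    integral_Iic_eq_integral_Iio (x := t - y)]

lemma aux_X {p lam lam' h h' : ℝ} {w w' : ℝ → ℝ}
    (hw : IsTWProfile p lam w) (hw' : IsTWProfile p lam' w') {X : ℝ → ℝ}
    (hX : ∀ τ, w (X τ - lam * τ + h) = w' (-(X τ) - lam' * τ + h')) (τ : ℝ) :
    DifferentiableAt ℝ X τ := by
  set f : ℝ × ℝ → ℝ := fun z => w (z.2 - lam * z.1 + h) - w' (-z.2 - lam' * z.1 + h') with hf
  have hc := hw.1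
  have hc' := hw'.1
  have cdf : ContDiffAt ℝ 2 f (τ, X τ) := by
    have : ContDiff ℝ 2 f := by
      apply ContDiff.sub
      · exact hc.comp (by fun_prop)
      · exact hc'.comp (by fun_prop)
    exact this.contDiffAt
  have hm : StrictMono w := strictMono_of_deriv_pos hw.2.2.2.1
  have hm' : StrictMono w' := strictMono_of_deriv_pos hw'.2.2.2.1
  have hdf : HasFDerivAt f (fderiv ℝ f (τ, X τ)) (τ, X τ) :=
    (cdf.differentiableAt (by norm_num)).hasFDerivAt
  set c := deriv w (X τ - lam * τ + h) + deriv w' (-(X τ) - lam' * τ + h') with hcdef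
  have hcpos : 0 < c := add_pos (hw.2.2.2.1 _) (hw'.2.2.2.1 _)
  have hval : (fderiv ℝ f (τ, X τ)) (0, 1) = c := by
    have hl : HasDerivAt (fun y : ℝ => (τ, y)) ((0 : ℝ), (1 : ℝ)) (X τ) :=
      (hasDerivAt_const _ _).prodMk (hasDerivAt_id _)
    have e1 : HasDerivAt (fun y => f (τ, y)) ((fderiv ℝ f (τ, X τ)) (0, 1)) (X τ) :=
      HasFDerivAt.comp_hasDerivAt (X τ) hdf hl
    have d1 : HasDerivAt (fun y : ℝ => y - lam * τ + h) 1 (X τ) :=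
      ((hasDerivAt_id _).sub_const _).add_const _
    have d2 : HasDerivAt (fun y : ℝ => -y - lam' * τ + h') (-1) (X τ) :=
      ((hasDerivAt_id _).neg.sub_const _).add_const _
    have e2 : HasDerivAt (fun y => f (τ, y)) (deriv w (X τ - lam * τ + h) * 1 -
        deriv w' (-(X τ) - lam' * τ + h') * (-1)) (X τ) :=
      (HasDerivAt.comp (X τ) (hc.differentiable (by norm_num) _).hasDerivAt d1).sub
        (HasDerivAt.comp (X τ) (hc'.differentiable (by norm_num) _).hasDerivAt d2)
    rw [e1.unique e2, hcdef]
    ring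
  have if₂ : (fderiv ℝ f (τ, X τ) ∘L .inr ℝ ℝ ℝ).IsInvertible := by
    refine ⟨ContinuousLinearEquiv.unitsEquivAut ℝ (Units.mk0 c hcpos.ne'), ?_⟩
    ext
    simp [hval]
  have hψ := (cdf.contDiffAt_implicitFunction (by norm_num) if₂).differentiableAt (by norm_num)
  refine hψ.congr_of_eventuallyEq ?_
  have hev := cdf.eventually_apply_implicitFunction (by norm_num) if₂
  filter_upwards [hev] with σ hσ
  have h0 : f (τ, X τ) = 0 := sub_eq_zero.2 (hX τ)
  rw [h0] at hσ
  have h1 := sub_eq_zero.1 hσ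
  have h2 := hX σ
  simp only at h1
  set y := cdf.implicitFunction (by norm_num) if₂ σ
  rcases lt_trichotomy (X σ) y with hlt | heq | hlt
  · have a1 := hm (show X σ - lam * σ + h < y - lam * σ + h by linarith)
    have a2 := hm' (show -y - lam' * σ + h' < -X σ - lam' * σ + h' by linarith)
    linarith
  · exact heq
  · have a1 := hm (show y - lam * σ + h < X σ - lam * σ + h by linarith)
    have a2 := hm' (show -X σ - lam' * σ + h' < -y - lam' * σ + h' by linarith)
    linarith

theorem deriv_integral_identity
    (p lam lam' h h' gam gam' C C' M : ℝ)
    (hp : 1 < p) (hlam : 1 ≤ lam) (hlam' : 1 ≤ lam')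
    (vl vl' : ℝ → ℝ)
    (hprof : IsTWProfile p lam vl) (hprof' : IsTWProfile p lam' vl')
    (hasym : HasExpAsym p lam gam C vl) (hasym' : HasExpAsym p lam' gam' C' vl')
    (hM : 0 < M)
    (hb : ∀ x ≤ (0:ℝ), vl x ≤ M * Real.exp x)
    (hb' : ∀ x ≤ (0:ℝ), vl' x ≤ M * Real.exp x)
    (v : ℝ → ℝ → ℝ)
    (hv : ∀ x τ, v x τ = min (vl (x - lam * τ + h)) (vl' (-x - lam' * τ + h')))
    (X : ℝ → ℝ)
    (hX : ∀ τ, vl (X τ - lam * τ + h) = vl' (-(X τ) - lam' * τ + h')) :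
    (∀ τ : ℝ, Integrable (fun x => v x τ) ∧ Integrable (fun x => v x τ ^ p)) ∧
    (∀ τ : ℝ, HasDerivAt (fun σ => ∫ x, v x σ ^ p)
      ((∫ x, v x τ ^ p) - (∫ x, v x τ)
        + deriv vl (X τ - lam * τ + h)
        + deriv vl' (-(X τ) - lam' * τ + h')) τ) := by
  have hm : StrictMono vl := strictMono_of_deriv_pos hprof.2.2.2.1
  have hm' : StrictMono vl' := strictMono_of_deriv_pos hprof'.2.2.2.1
  have hv1 : ∀ τ, ∀ x ≤ X τ, v x τ = vl (x + (-lam * τ + h)) := by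
    intro τ x hx
    rw [hv, min_eq_left]
    · congr 1; ring
    · have a1 := hm.monotone (show x - lam * τ + h ≤ X τ - lam * τ + h by linarith)
      have a2 := hm'.monotone (show -X τ - lam' * τ + h' ≤ -x - lam' * τ + h' by linarith)
      linarith [hX τ]
  have hv2 : ∀ τ, ∀ x, X τ < x → v x τ = vl' ((-lam' * τ + h') - x) := by
    intro τ x hx
    rw [hv, min_eq_right]
    · congr 1; ring
    · have a1 := hm.monotone (show X τ - lam * τ + h ≤ x - lam * τ + h by linarith)
      have a2 := hm'.monotone (show -x - lam' * τ + h' ≤ -X τ - lam' * τ + h' by linarith)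
      linarith [hX τ]
  have ea : ∀ τ, X τ + (-lam * τ + h) = X τ - lam * τ + h := fun τ => by ring
  have eb : ∀ τ, (-lam' * τ + h') - X τ = -(X τ) - lam' * τ + h' := fun τ => by ring
  have s1 := fun τ => aux_split (k := fun x => v x τ) (aux_int hprof hb _) (aux_int hprof' hb' _)
    (hv1 τ) (hv2 τ)
  have s2 := fun τ => aux_split (k := fun x => v x τ ^ p) (f := fun x => vl x ^ p)
    (g := fun x => vl' x ^ p) (s := -lam * τ + h) (t := -lam' * τ + h') (y := X τ)
    (aux_intp hp hprof hb _) (aux_intp hp hprof' hb' _)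
    (fun x hx => by simp only [hv1 τ x hx]) (fun x hx => by simp only [hv2 τ x hx])
  simp only [ea, eb] at s1 s2
  refine ⟨fun τ => ⟨(s1 τ).1, (s2 τ).1⟩, fun τ => ?_⟩
  have hF : (fun σ => ∫ x, v x σ ^ p) = fun σ => (∫ x in Iic (X σ - lam * σ + h), vl x ^ p) +
      ∫ x in Iic (-(X σ) - lam' * σ + h'), vl' x ^ p := funext fun σ => (s2 σ).2
  have hXd := (aux_X hprof hprof' hX τ).hasDerivAt
  have d1 : HasDerivAt (fun σ : ℝ => X σ - lam * σ + h) (deriv X τ - lam * 1) τ :=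
    (hXd.sub ((hasDerivAt_id τ).const_mul lam)).add_const _
  have d2 : HasDerivAt (fun σ : ℝ => -(X σ) - lam' * σ + h') (-deriv X τ - lam' * 1) τ :=
    (hXd.neg.sub ((hasDerivAt_id τ).const_mul lam')).add_const _
  have g1 := HasDerivAt.comp τ (aux_hasDeriv (aux_cont hp hprof) (aux_intp hp hprof hb) _) d1
  have g2 := HasDerivAt.comp τ (aux_hasDeriv (aux_cont hp hprof') (aux_intp hp hprof' hb') _) d2
  have q1 := aux_Q hp hlam hprof hb (X τ - lam * τ + h)
  have q2 := aux_Q hp hlam' hprof' hb' (-(X τ) - lam' * τ + h')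
  rw [(s1 τ).2, (s2 τ).2, hF]
  refine (g1.add g2).congr_deriv ?_
  rw [← hX τ] at q2 ⊢
  linear_combination q1 + q2
end

section
/- Let p > 1 and λ, λ' > 0, let v_λ and v_{λ'} be traveling-wave profiles with speeds λ and λ' respectively, and let a, b ∈ ℝ. Define f : ℝ → ℝ by f(x) = min( v_λ(x + a), v_{λ'}(−x + b) ). Then f is a distributional supersolution of w'' + w^p − w = 0: for every nonnegative twice continuously differentiable function φ : ℝ → ℝ with compact support, ∫_ℝ ( f(x) φ''(x) + (f(x)^p − f(x)) φ(x) ) dx ≤ 0. -/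
open Real Filter Topology MeasureTheory

/-- Integration by parts for a `C²` supersolution on an interval. -/
lemma aux_interval (p : ℝ) (hp : 1 < p) (g φ : ℝ → ℝ) (hg : ContDiff ℝ 2 g)
    (hsup : ∀ x, deriv (deriv g) x + g x ^ p - g x ≤ 0)
    (hφ : ContDiff ℝ 2 φ) (hnn : ∀ x, 0 ≤ φ x) (s t : ℝ) (hst : s ≤ t) :
    (∫ x in s..t, (g x * deriv (deriv φ) x + (g x ^ p - g x) * φ x)) ≤
      (g t * deriv φ t - deriv g t * φ t) - (g s * deriv φ s - deriv g s * φ s) := by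
  have key : ∀ h : ℝ → ℝ, ContDiff ℝ 2 h → Differentiable ℝ h ∧ Differentiable ℝ (deriv h) ∧
      Continuous (deriv (deriv h)) := by
    intro h hh
    have h1 : ContDiff ℝ 1 (deriv h) := by
      have := (contDiff_succ_iff_deriv (n := 1) (f := h)).1 (by simpa [one_add_one_eq_two] using hh)
      exact this.2.2
    exact ⟨hh.differentiable (by norm_num), h1.differentiable (by norm_num),
      h1.continuous_deriv (le_refl _)⟩
  obtain ⟨g0, g1, g2⟩ := key g hg
  obtain ⟨p0, p1, p2⟩ := key φ hφ
  have cg := g0.continuous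
  have cp := p0.continuous
  have cgp : Continuous fun x => g x ^ p := cg.rpow_const (fun x => Or.inr (by linarith))
  have hd : ∀ x, HasDerivAt (fun x => g x * deriv φ x - deriv g x * φ x)
      (g x * deriv (deriv φ) x - deriv (deriv g) x * φ x) x := by
    intro x
    have := (((g0 x).hasDerivAt).fun_mul ((p1 x).hasDerivAt)).fun_sub
      (((g1 x).hasDerivAt).fun_mul ((p0 x).hasDerivAt))
    refine this.congr_deriv ?_
    ring
  have c1 : Continuous fun x => g x * deriv (deriv φ) x - deriv (deriv g) x * φ x := by fun_prop
  have c2 : Continuous fun x => g x * deriv (deriv φ) x + (g x ^ p - g x) * φ x := by fun_prop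
  rw [← intervalIntegral.integral_eq_sub_of_hasDerivAt (fun x _ => hd x)
    (c1.intervalIntegrable s t)]
  apply intervalIntegral.integral_mono_on hst (c2.intervalIntegrable s t)
    (c1.intervalIntegrable s t)
  intro x _
  nlinarith [mul_nonneg (neg_nonneg.2 (hsup x)) (hnn x)]

theorem min_is_distributional_supersolution
    (p lam lam' a b : ℝ)
    (hp : 1 < p) (hlam : 0 < lam) (hlam' : 0 < lam')
    (vl vl' : ℝ → ℝ)
    (hprof : IsTWProfile p lam vl) (hprof' : IsTWProfile p lam' vl')
    (f : ℝ → ℝ)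
    (hf : ∀ x, f x = min (vl (x + a)) (vl' (-x + b))) :
    ∀ φ : ℝ → ℝ, ContDiff ℝ 2 φ → HasCompactSupport φ → (∀ x, 0 ≤ φ x) →
      (∫ x, (f x * deriv (deriv φ) x + (f x ^ p - f x) * φ x)) ≤ 0 := by
  intro φ hφ hcs hnn
  obtain ⟨hv, hpos, -, hd, hode, hbot, htop⟩ := hprof
  obtain ⟨hv', hpos', -, hd', hode', hbot', htop'⟩ := hprof'
  set u : ℝ → ℝ := fun x => vl (x + a) with hu
  set w : ℝ → ℝ := fun x => vl' (-x + b) with hw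
  have uC : ContDiff ℝ 2 u := hv.comp (contDiff_id.add contDiff_const)
  have wC : ContDiff ℝ 2 w := hv'.comp (contDiff_neg.add contDiff_const)
  have du : deriv u = fun x => deriv vl (x + a) := by
    funext x; exact deriv_comp_add_const vl a x
  have ddu : deriv (deriv u) = fun x => deriv (deriv vl) (x + a) := by
    rw [du]; funext x; exact deriv_comp_add_const (deriv vl) a x
  have refl : ∀ h : ℝ → ℝ, ∀ x, deriv (fun x => h (-x + b)) x = - deriv h (-x + b) := by
    intro h x
    rw [deriv_comp_neg (fun y => h (y + b)) x, deriv_comp_add_const]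
  have dw : deriv w = fun x => - deriv vl' (-x + b) := by
    funext x; exact refl vl' x
  have ddw : deriv (deriv w) = fun x => deriv (deriv vl') (-x + b) := by
    rw [dw]; funext x
    rw [deriv.fun_neg, refl (deriv vl') x, neg_neg]
  have usup : ∀ x, deriv (deriv u) x + u x ^ p - u x ≤ 0 := by
    intro x
    have h1 := hode (x + a)
    have h2 : 0 ≤ lam * p * vl (x + a) ^ (p - 1) * deriv vl (x + a) := by
      have := hpos (x + a); have := hd (x + a); positivity
    rw [ddu]; simp only [hu]; linarith
  have wsup : ∀ x, deriv (deriv w) x + w x ^ p - w x ≤ 0 := by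
    intro x
    have h1 := hode' (-x + b)
    have h2 : 0 ≤ lam' * p * vl' (-x + b) ^ (p - 1) * deriv vl' (-x + b) := by
      have := hpos' (-x + b); have := hd' (-x + b); positivity
    rw [ddw]; simp only [hw]; linarith
  have mv : StrictMono vl := strictMono_of_deriv_pos hd
  have mv' : StrictMono vl' := strictMono_of_deriv_pos hd'
  have umono : Monotone u := fun x y h => mv.monotone (by linarith)
  have wanti : Antitone w := fun x y h => mv'.monotone (by linarith)
  have utop : Tendsto u atTop (𝓝 1) := htop.comp (tendsto_atTop_add_const_right _ a tendsto_id)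
  have ubot : Tendsto u atBot (𝓝 0) := hbot.comp (tendsto_atBot_add_const_right _ a tendsto_id)
  have wtop : Tendsto w atTop (𝓝 0) :=
    hbot'.comp (tendsto_atBot_add_const_right _ b tendsto_neg_atTop_atBot)
  have wbot : Tendsto w atBot (𝓝 1) :=
    htop'.comp (tendsto_atTop_add_const_right _ b tendsto_neg_atBot_atTop)
  obtain ⟨c, hc⟩ : ∃ c, u c = w c := by
    obtain ⟨x1, h1⟩ := (ubot.eventually_lt wbot (by norm_num)).exists
    obtain ⟨x2, h2⟩ := (wtop.eventually_lt utop (by norm_num)).exists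
    exact intermediate_value_univ₂ uC.continuous wC.continuous h1.le h2.le
  have fl : ∀ x, x ≤ c → f x = u x := fun x hx => by
    rw [hf x]; exact min_eq_left (((umono hx).trans hc.le).trans (wanti hx))
  have fr : ∀ x, c ≤ x → f x = w x := fun x hx => by
    rw [hf x]; exact min_eq_right (((wanti hx).trans hc.ge).trans (umono hx))
  obtain ⟨R, hR⟩ : ∃ R : ℝ, tsupport φ ⊆ Metric.ball c R := 
    hcs.isCompact.isBounded.subset_ball c
  have hz : ∀ x, x ∉ Metric.ball c R → φ x = 0 ∧ deriv φ x = 0 ∧ deriv (deriv φ) x = 0 := by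
    intro x hx
    have h0 : x ∉ tsupport φ := fun h => hx (hR h)
    have h1 : x ∉ tsupport (deriv φ) := fun h => h0 (tsupport_deriv_subset h)
    have h2 : x ∉ tsupport (deriv (deriv φ)) := fun h => h1 (tsupport_deriv_subset h)
    exact ⟨image_eq_zero_of_notMem_tsupport h0, image_eq_zero_of_notMem_tsupport h1,
      image_eq_zero_of_notMem_tsupport h2⟩
  set S := max R 0 with hS
  have hS0 : 0 ≤ S := le_max_right _ _
  have hSR : R ≤ S := le_max_left _ _
  have zl := hz (c - S) (by rw [Metric.mem_ball, Real.dist_eq]; simp [abs_of_nonneg hS0, hSR])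
  have zr := hz (c + S) (by rw [Metric.mem_ball, Real.dist_eq]; simp [abs_of_nonneg hS0, hSR])
  have cf : Continuous f := by
    have : f = fun x => min (u x) (w x) := funext hf
    rw [this]; exact uC.continuous.min wC.continuous
  have c2 : Continuous (deriv (deriv φ)) := by
    have h1 := (contDiff_succ_iff_deriv (n := 1) (f := φ)).1
      (by simpa [one_add_one_eq_two] using hφ)
    exact h1.2.2.continuous_deriv (le_refl _)
  have cφ := hφ.continuous
  have cfp : Continuous fun x => f x ^ p := cf.rpow_const (fun x => Or.inr (by linarith))
  have cI : Continuous fun x => f x * deriv (deriv φ) x + (f x ^ p - f x) * φ x := by fun_prop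
  rw [← intervalIntegral.integral_eq_integral_of_support_subset (a := c - S) (b := c + S),
    ← intervalIntegral.integral_add_adjacent_intervals (b := c)
      (cI.intervalIntegrable _ _) (cI.intervalIntegrable _ _)]
  · have e1 : (∫ x in (c - S)..c, (f x * deriv (deriv φ) x + (f x ^ p - f x) * φ x)) =
        ∫ x in (c - S)..c, (u x * deriv (deriv φ) x + (u x ^ p - u x) * φ x) := by
      apply intervalIntegral.integral_congr
      intro x hx
      rw [Set.uIcc_of_le (by linarith)] at hx
      simp only [fl x hx.2]
    have e2 : (∫ x in c..(c + S), (f x * deriv (deriv φ) x + (f x ^ p - f x) * φ x)) =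
        ∫ x in c..(c + S), (w x * deriv (deriv φ) x + (w x ^ p - w x) * φ x) := by
      apply intervalIntegral.integral_congr
      intro x hx
      rw [Set.uIcc_of_le (by linarith)] at hx
      simp only [fr x hx.1]
    have i1 := aux_interval p hp u φ uC usup hφ hnn (c - S) c (by linarith)
    have i2 := aux_interval p hp w φ wC wsup hφ hnn c (c + S) (by linarith)
    rw [zl.1, zl.2.1] at i1
    rw [zr.1, zr.2.1] at i2
    have d1 : 0 ≤ deriv u c * φ c := by
      rw [du]; exact mul_nonneg (hd _).le (hnn c)
    have d2 : deriv w c * φ c ≤ 0 := by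
      rw [dw]; exact mul_nonpos_of_nonpos_of_nonneg (neg_nonpos.2 (hd' _).le) (hnn c)
    rw [e1, e2]
    rw [hc] at i1
    linarith
  · intro x hx
    by_contra hn
    apply hx
    obtain ⟨h0, -, h2⟩ := hz x (by
      intro hb
      rw [Metric.mem_ball, Real.dist_eq, abs_lt] at hb
      exact hn ⟨by linarith [hb.1], by linarith [hb.2]⟩)
    simp [h0, h2]
end

section
/- Let p > 1 and c > 0, and define v : ℝ → ℝ by v(x) = (1 + c e^{−(p−1)x})^{−1/(p−1)}. Then v is twice continuously differentiable, satisfies v''(x) + p v(x)^{p−1} v'(x) + v(x)^p − v(x) = 0 for all x ∈ ℝ, and moreover lim_{x→+∞} e^{(p−1)x} (1 − v(x)) = c/(p−1). -/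
open Real Filter Topology

theorem barenblatt_profile
    (p c : ℝ) (hp : 1 < p) (hc : 0 < c)
    (v : ℝ → ℝ)
    (hv : ∀ x, v x = (1 + c * Real.exp (-(p - 1) * x)) ^ (-(1 / (p - 1)))) :
    ContDiff ℝ 2 v ∧
    (∀ x, deriv (deriv v) x + p * v x ^ (p - 1) * deriv v x + v x ^ p - v x = 0) ∧
    Tendsto (fun x => Real.exp ((p - 1) * x) * (1 - v x)) atTop
      (𝓝 (c / (p - 1))) := by
  have hq : 0 < p - 1 := by linarith
  have hw : ∀ x, 0 < 1 + c * Real.exp (-(p - 1) * x) := fun x => by positivity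
  have hvpos : ∀ x, 0 < v x := fun x => by rw [hv]; exact Real.rpow_pos_of_pos (hw x) _
  have hvp1 : ∀ x, v x ^ (p - 1) = (1 + c * Real.exp (-(p - 1) * x))⁻¹ := fun x => by
    rw [hv, ← Real.rpow_mul (hw x).le, ← Real.rpow_neg_one]
    congr 1
    field_simp
  have hvp : ∀ x, v x ^ p = v x * (1 + c * Real.exp (-(p - 1) * x))⁻¹ := fun x => by
    rw [← hvp1, ← Real.rpow_one_add' (hvpos x).le (by linarith)]
    congr 1
    ring
  have hfun : v = fun x => (1 + c * Real.exp (-(p - 1) * x)) ^ (-(1 / (p - 1))) := funext hv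
  have hd : ∀ x, HasDerivAt v (v x - v x ^ p) x := fun x => by
    have h1 : HasDerivAt (fun x : ℝ => 1 + c * Real.exp (-(p - 1) * x))
        (c * (Real.exp (-(p - 1) * x) * (-(p - 1) * 1))) x :=
      ((((hasDerivAt_id x).const_mul (-(p - 1))).exp).const_mul c).const_add 1
    have h2 := h1.rpow_const (p := -(1 / (p - 1))) (Or.inl (hw x).ne')
    rw [← hfun] at h2
    convert h2 using 1
    rw [hvp, Real.rpow_sub_one (hw x).ne', ← hv]
    have := (hw x).ne'
    field_simp
    ring
  have hderiv : deriv v = fun x => v x - v x ^ p := funext fun x => (hd x).deriv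
  refine ⟨?_, ?_, ?_⟩
  · rw [hfun]
    exact ContDiff.rpow_const_of_ne (by fun_prop) (fun x => (hw x).ne')
  · intro x
    have h2 : HasDerivAt (deriv v)
        ((v x - v x ^ p) - (v x - v x ^ p) * p * v x ^ (p - 1)) x := by
      rw [hderiv]
      exact (hd x).sub ((hd x).rpow_const (Or.inl (hvpos x).ne'))
    rw [h2.deriv, (hd x).deriv]
    ring
  · have h1 : HasDerivAt (fun t : ℝ => (1 + t) ^ (-(1 / (p - 1)))) (-(1 / (p - 1))) 0 := by
      have := ((hasDerivAt_id (0:ℝ)).const_add 1).rpow_const (p := -(1 / (p - 1)))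
        (Or.inl (by simp))
      simpa using this
    have h2 := hasDerivAt_iff_tendsto_slope.1 h1
    have h3 : Tendsto (fun x : ℝ => c * Real.exp (-(p - 1) * x)) atTop (𝓝[≠] 0) := by
      rw [tendsto_nhdsWithin_iff]
      refine ⟨?_, Eventually.of_forall fun x => by simp [hc.ne']⟩
      have h4 : Tendsto (fun x : ℝ => -(p - 1) * x) atTop atBot :=
        tendsto_id.const_mul_atTop_of_neg (by linarith)
      simpa using (Real.tendsto_exp_atBot.comp h4).const_mul c
    have h5 := (h2.comp h3).const_mul (-c)
    have e : -c * -(1 / (p - 1)) = c / (p - 1) := by ring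
    rw [e] at h5
    refine h5.congr fun x => ?_
    simp only [Function.comp, slope_def_field]
    rw [← hv]
    have : Real.exp (-(p - 1) * x) = (Real.exp ((p - 1) * x))⁻¹ := by
      rw [← Real.exp_neg]; congr 1; ring
    rw [this]
    have := (Real.exp_pos ((p - 1) * x)).ne'
    simp
    field_simp
    ring
end

section
/- In the merged traveling-wave configuration with λ > 1 and λ' > 1, assume additionally there is M > 0 with v_λ(x) ≤ M e^x and v_{λ'}(x) ≤ M e^x for all x ≤ 0. Define v(x,τ) = min( v_λ(x + h − λτ), v_{λ'}(−x + h' − λ'τ) ) and v̄(x,τ) = min( v_λ(x − λτ), v_{λ'}(−x − λ'τ) ). Then liminf_{τ→−∞} | ∫_ℝ ( v̄(x,τ)^p − v(x,τ)^p ) dx | ≥ |h + h'|/2. -/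
open Real Filter Topology MeasureTheory

lemma aux_pos (g : ℝ → ℝ) (hc : Continuous g) (hm : Monotone g) (h0 : ∀ x, 0 ≤ g x)
    (h1 : ∀ x, g x ≤ 1) (hbot : Tendsto g atBot (𝓝 0)) (htop : Tendsto g atTop (𝓝 1))
    (d : ℝ) (hd : 0 ≤ d) :
    Integrable (fun y => g (y + d) - g y) ∧ ∫ y, (g (y + d) - g y) = d := by
  set G : ℝ → ℝ := fun y => ∫ t in (0:ℝ)..d, g (y + t) with hG
  have hGP : ∀ y, G y = (∫ t in (0:ℝ)..(y + d), g t) - ∫ t in (0:ℝ)..y, g t := by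
    intro y
    rw [hG]
    simp only
    rw [intervalIntegral.integral_comp_add_left (fun t => g t) y, add_zero,
      intervalIntegral.integral_interval_sub_left] <;>
    exact hc.intervalIntegrable _ _
  have hP : ∀ y, HasDerivAt (fun y => ∫ t in (0:ℝ)..y, g t) (g y) y := fun y =>
    intervalIntegral.integral_hasDerivAt_right (hc.intervalIntegrable _ _)
      hc.stronglyMeasurable.stronglyMeasurableAtFilter hc.continuousAt
  have hder : ∀ y, HasDerivAt G (g (y + d) - g y) y := by
    intro y
    have : G = fun y => (∫ t in (0:ℝ)..(y + d), g t) - ∫ t in (0:ℝ)..y, g t := funext hGP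
    rw [this]
    exact ((hP (y + d)).comp_add_const y d).sub (hP y)
  have hlim : ∀ (l : Filter ℝ) [l.IsCountablyGenerated] (a : ℝ),
      (∀ t : ℝ, Tendsto (fun y => g (y + t)) l (𝓝 a)) → Tendsto G l (𝓝 (d * a)) := by
    intro l _ a hl
    have : d * a = ∫ t in (0:ℝ)..d, a := by simp
    rw [this]
    refine intervalIntegral.tendsto_integral_filter_of_dominated_convergence (fun _ => 1) ?_ ?_ ?_ ?_
    · exact Eventually.of_forall fun y => (by fun_prop : Continuous fun t => g (y + t)).aestronglyMeasurable
    · refine Eventually.of_forall fun y => Eventually.of_forall fun t _ => ?_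
      rw [Real.norm_eq_abs, abs_of_nonneg (h0 _)]
      exact h1 _
    · exact intervalIntegrable_const
    · exact Eventually.of_forall fun t _ => hl t
  have hGtop := hlim atTop 1 fun t => htop.comp (tendsto_atTop_add_const_right _ t tendsto_id)
  have hGbot := hlim atBot 0 fun t => hbot.comp (tendsto_atBot_add_const_right _ t tendsto_id)
  have hnn : ∀ y, 0 ≤ g (y + d) - g y := fun y => sub_nonneg.2 (hm (by linarith))
  have hint : Integrable (fun y => g (y + d) - g y) := by
    have i1 : IntegrableOn (fun y => g (y + d) - g y) (Set.Ioi 0) :=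
      integrableOn_Ioi_deriv_of_nonneg' (fun x _ => hder x) (fun x _ => hnn x) hGtop
    have i2 : IntegrableOn (fun y => g (y + d) - g y) (Set.Iic 0) :=
      integrableOn_Iic_of_intervalIntegral_norm_bounded (d + 1) (0:ℝ) (a := fun n : ℝ => n)
        (l := atBot) (fun n => ((by fun_prop : Continuous (fun y => g (y + d) - g y)).integrableOn_Icc).mono_set Set.Ioc_subset_Icc_self)
        tendsto_id (by
          have hG0 : G 0 ≤ d := by
            refine ge_of_tendsto (f := G) (x := atTop) (by simpa using hGtop) ?_
            have hmono : Monotone G := monotone_of_deriv_nonneg (fun x => (hder x).differentiableAt)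
              (fun x => by rw [(hder x).deriv]; exact hnn x)
            filter_upwards [eventually_ge_atTop 0] with x hx using hmono hx
          filter_upwards [eventually_le_atBot 0, hGbot.eventually_const_lt (u := -1) (by simp)] with n hn hn2
          have : ∀ y, ‖g (y + d) - g y‖ = g (y + d) - g y := fun y => by
            rw [Real.norm_eq_abs, abs_of_nonneg (hnn y)]
          simp only [this]
          rw [intervalIntegral.integral_eq_sub_of_hasDerivAt (fun x _ => hder x)
            ((by fun_prop : Continuous (fun y => g (y + d) - g y)).intervalIntegrable _ _)]
          linarith)
    have := i2.union i1
    rwa [Set.Iic_union_Ioi, integrableOn_univ] at this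
  refine ⟨hint, ?_⟩
  rw [integral_of_hasDerivAt_of_tendsto hder hint hGbot hGtop]
  ring

lemma aux_all (g : ℝ → ℝ) (hc : Continuous g) (hm : Monotone g) (h0 : ∀ x, 0 ≤ g x)
    (h1 : ∀ x, g x ≤ 1) (hbot : Tendsto g atBot (𝓝 0)) (htop : Tendsto g atTop (𝓝 1))
    (d : ℝ) :
    Integrable (fun y => g y - g (y + d)) ∧ ∫ y, (g y - g (y + d)) = -d := by
  rcases le_total 0 d with hd | hd
  · obtain ⟨a, b⟩ := aux_pos g hc hm h0 h1 hbot htop d hd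
    have e : (fun y => g y - g (y + d)) = fun y => -(g (y + d) - g y) := by
      funext y; ring
    rw [e]
    exact ⟨a.neg, by rw [integral_neg, b]⟩
  · obtain ⟨a, b⟩ := aux_pos g hc hm h0 h1 hbot htop (-d) (by linarith)
    have e : (fun y => g y - g (y + d)) = fun y => (fun y => g (y + -d) - g y) (y + d) := by
      funext y; simp
    rw [e]
    exact ⟨a.comp_add_right d, by rw [integral_add_right_eq_self (fun y => g (y + -d) - g y), b]⟩

lemma aux_lim (g : ℝ → ℝ) (hc : Continuous g) (hm : Monotone g) (h0 : ∀ x, 0 ≤ g x)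
    (h1 : ∀ x, g x ≤ 1) (hbot : Tendsto g atBot (𝓝 0)) (htop : Tendsto g atTop (𝓝 1))
    (d : ℝ) (c : ℝ → ℝ → ℝ) (hcc : ∀ τ, Continuous (c τ))
    (hcl : ∀ y, Tendsto (fun τ => c τ y) atBot (𝓝 1)) :
    (∀ τ, Integrable (fun y => min (g y) (c τ y) - min (g (y + d)) (c τ y))) ∧
    Tendsto (fun τ => ∫ y, (min (g y) (c τ y) - min (g (y + d)) (c τ y))) atBot (𝓝 (-d)) := by
  obtain ⟨a, b⟩ := aux_all g hc hm h0 h1 hbot htop d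
  have hcont : ∀ τ, Continuous (fun y => min (g y) (c τ y) - min (g (y + d)) (c τ y)) := by
    intro τ
    have := hcc τ
    fun_prop
  have hbd : ∀ τ y, ‖min (g y) (c τ y) - min (g (y + d)) (c τ y)‖ ≤ ‖g y - g (y + d)‖ := by
    intro τ y
    have := abs_min_sub_min_le_max (g y) (c τ y) (g (y + d)) (c τ y)
    simpa using this
  refine ⟨fun τ => a.mono (hcont τ).aestronglyMeasurable (Eventually.of_forall (hbd τ)), ?_⟩
  rw [← b]
  refine tendsto_integral_filter_of_dominated_convergence _
    (Eventually.of_forall fun τ => (hcont τ).aestronglyMeasurable)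
    (Eventually.of_forall fun τ => Eventually.of_forall (hbd τ)) a.norm
    (Eventually.of_forall fun y => ?_)
  have := ((tendsto_const_nhds (x := g y)).min (hcl y)).sub
    ((tendsto_const_nhds (x := g (y + d))).min (hcl y))
  rwa [min_eq_left (h1 _), min_eq_left (h1 _)] at this

lemma aux_prof (p lam : ℝ) (hp : 1 < p) (u : ℝ → ℝ) (hu : IsTWProfile p lam u) :
    Continuous (fun x => u x ^ p) ∧ Monotone (fun x => u x ^ p) ∧ (∀ x, 0 ≤ u x ^ p) ∧
    (∀ x, u x ^ p ≤ 1) ∧ Tendsto (fun x => u x ^ p) atBot (𝓝 0) ∧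
    Tendsto (fun x => u x ^ p) atTop (𝓝 1) := by
  obtain ⟨hC, hpos, hle, hder, -, hb, ht⟩ := hu
  have hp0 : 0 ≤ p := by linarith
  refine ⟨hC.continuous.rpow_const fun x => Or.inr hp0, fun x y hxy =>
    Real.rpow_le_rpow (hpos x).le ((strictMono_of_deriv_pos hder).monotone hxy) hp0,
    fun x => Real.rpow_nonneg (hpos x).le _, fun x => Real.rpow_le_one (hpos x).le (hle x) hp0, ?_, ?_⟩
  · have := hb.rpow_const (p := p) (Or.inr hp0)
    rwa [Real.zero_rpow (by linarith)] at this
  · have := ht.rpow_const (p := p) (Or.inr hp0)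
    rwa [Real.one_rpow] at this

lemma aux_min (p a b : ℝ) (hp : 1 < p) (ha : 0 < a) (hb : 0 < b) :
    (min a b) ^ p = min (a ^ p) (b ^ p) := by
  rcases le_total a b with h | h
  · rw [min_eq_left h, min_eq_left (Real.rpow_le_rpow ha.le h (by linarith))]
  · rw [min_eq_right h, min_eq_right (Real.rpow_le_rpow hb.le h (by linarith))]

theorem shifted_approximations_integral_gap
    (p lam lam' h h' gam gam' C C' M : ℝ)
    (hp : 1 < p) (hlam : 1 < lam) (hlam' : 1 < lam')
    (vl vl' : ℝ → ℝ)
    (hprof : IsTWProfile p lam vl) (hprof' : IsTWProfile p lam' vl')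
    (hasym : HasExpAsym p lam gam C vl) (hasym' : HasExpAsym p lam' gam' C' vl')
    (hM : 0 < M)
    (hb : ∀ x ≤ (0:ℝ), vl x ≤ M * Real.exp x)
    (hb' : ∀ x ≤ (0:ℝ), vl' x ≤ M * Real.exp x)
    (v vbar : ℝ → ℝ → ℝ)
    (hv : ∀ x τ, v x τ = min (vl (x + h - lam * τ)) (vl' (-x + h' - lam' * τ)))
    (hvbar : ∀ x τ, vbar x τ = min (vl (x - lam * τ)) (vl' (-x - lam' * τ))) :
    |h + h'| / 2 ≤
      Filter.liminf (fun τ => |∫ x, (vbar x τ ^ p - v x τ ^ p)|) Filter.atBot := by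
  obtain ⟨fc, fm, f0, f1, fb, ft⟩ := aux_prof p lam hp vl hprof
  obtain ⟨gc, gm, g0, g1, gb, gt⟩ := aux_prof p lam' hp vl' hprof'
  have hpos := hprof.2.1
  have hpos' := hprof'.2.1
  set f : ℝ → ℝ := fun x => vl x ^ p with hf
  set g : ℝ → ℝ := fun x => vl' x ^ p with hg
  have hshift : ∀ a : ℝ, Tendsto (fun τ : ℝ => a - (lam + lam') * τ) atBot atTop := by
    intro a
    have h1 : Tendsto (fun τ : ℝ => (-(lam + lam')) * τ) atBot atTop :=
      tendsto_id.const_mul_atBot_of_neg (by linarith)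
    refine (tendsto_atTop_add_const_left _ a h1).congr fun τ => by ring
  obtain ⟨i1, t1⟩ := aux_lim f fc fm f0 f1 fb ft h (fun τ y => g (-y - (lam + lam') * τ))
    (fun τ => by fun_prop) (fun y => gt.comp (hshift (-y)))
  obtain ⟨i2, t2⟩ := aux_lim g gc gm g0 g1 gb gt h' (fun τ y => f (-y + h - (lam + lam') * τ))
    (fun τ => by fun_prop) (fun y => ft.comp (hshift (-y + h)))
  have key : ∀ τ, ∫ x, (vbar x τ ^ p - v x τ ^ p) =
      (∫ y, (min (f y) (g (-y - (lam + lam') * τ)) - min (f (y + h)) (g (-y - (lam + lam') * τ))))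
      + ∫ y, (min (g y) (f (-y + h - (lam + lam') * τ))
          - min (g (y + h')) (f (-y + h - (lam + lam') * τ))) := by
    intro τ
    have j1 := (i1 τ).comp_add_right (-(lam * τ))
    have j2 := ((i2 τ).comp_add_right (-(lam' * τ))).comp_neg
    rw [← integral_add_right_eq_self (fun y => (min (f y) (g (-y - (lam + lam') * τ))
          - min (f (y + h)) (g (-y - (lam + lam') * τ)))) (-(lam * τ)),
      ← integral_add_right_eq_self (fun y => (min (g y) (f (-y + h - (lam + lam') * τ))
          - min (g (y + h')) (f (-y + h - (lam + lam') * τ)))) (-(lam' * τ)),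
      ← integral_neg_eq_self (fun y => (min (g (y + -(lam' * τ))) (f (-(y + -(lam' * τ)) + h - (lam + lam') * τ))
          - min (g (y + -(lam' * τ) + h')) (f (-(y + -(lam' * τ)) + h - (lam + lam') * τ)))),
      ← integral_add j1 j2]
    refine integral_congr_ae (Eventually.of_forall fun x => ?_)
    simp only [hv, hvbar]
    rw [aux_min p _ _ hp (hpos _) (hpos' _), aux_min p _ _ hp (hpos _) (hpos' _)]
    change min (f _) (g _) - min (f _) (g _) = _
    rw [show x + -(lam * τ) = x - lam * τ by ring,
      show -(x - lam * τ) - (lam + lam') * τ = -x - lam' * τ by ring,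
      show x - lam * τ + h = x + h - lam * τ by ring,
      show -x + -(lam' * τ) = -x - lam' * τ by ring,
      show -(-x - lam' * τ) + h - (lam + lam') * τ = x + h - lam * τ by ring,
      show -x - lam' * τ + h' = -x + h' - lam' * τ by ring,
      min_comm (g (-x - lam' * τ)), min_comm (g (-x + h' - lam' * τ))]
    ring
  have hlimit := ((t1.add t2).congr fun τ => (key τ).symm).abs
  rw [hlimit.liminf_eq, show -h + -h' = -(h + h') by ring, abs_neg]
  linarith [abs_nonneg (h + h')]
end

section
/- In the merged traveling-wave configuration, set v(x,τ) = min(u₁(x,τ), u₂(x,τ)) and d = (γ_λ γ_{λ'} + (p − 1))/p. Let τ₀ ∈ ℝ, D > 0, and let u : ℝ × (−∞, τ₀] → ℝ be a function with 0 ≤ u(x,τ) ≤ v(x,τ) for all (x,τ), such that for each τ ≤ τ₀ the function x ↦ (v^p − u^p)(x,τ) is Lebesgue integrable and ∫_ℝ ( v(x,τ)^p − u(x,τ)^p ) dx ≤ D e^{dτ}. Then there exist constants D̄ ≥ C̄ > 0 and τ₁ ≤ τ₀ such that 1 − D̄ e^{dτ} ≤ sup_{x∈ℝ} u(x,τ)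 ≤ 1 − C̄ e^{dτ} for all τ ≤ τ₁. -/
open Real Filter Topology MeasureTheory

lemma asym_bounds {p lam gam C : ℝ} {v : ℝ → ℝ} (H : HasExpAsym p lam gam C v) :
    ∃ X, ∀ x, X ≤ x → C / 2 * Real.exp (-(gam * x)) ≤ 1 - v x ∧
      1 - v x ≤ 2 * C * Real.exp (-(gam * x)) := by
  obtain ⟨_, hC, _, ht⟩ := H
  have h1 := ht.eventually (lt_mem_nhds (show C / 2 < C by linarith))
  have h2 := ht.eventually (gt_mem_nhds (show C < 2 * C by linarith))
  obtain ⟨X, hX⟩ := eventually_atTop.1 (h1.and h2)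
  refine ⟨X, fun x hx => ?_⟩
  obtain ⟨a, b⟩ := hX x hx
  have e : 1 - v x = Real.exp (gam * x) * (1 - v x) * Real.exp (-(gam * x)) := by
    rw [mul_right_comm, ← Real.exp_add]; simp
  have hpos := Real.exp_pos (-(gam * x))
  constructor
  · rw [e]; exact mul_le_mul_of_nonneg_right a.le hpos.le
  · rw [e]; exact mul_le_mul_of_nonneg_right b.le hpos.le

lemma prof_mono {p lam : ℝ} {v : ℝ → ℝ} (H : IsTWProfile p lam v) : Monotone v :=
  (strictMono_of_deriv_pos H.2.2.2.1).monotone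

lemma pow_diff_lower {p a b : ℝ} (hp : 1 < p) (hb : 0 ≤ b) (hba : b ≤ a) (ha : 1 / 2 ≤ a) :
    (1 / 2 : ℝ) ^ (p - 1) * (a - b) ≤ a ^ p - b ^ p := by
  have ha0 : 0 < a := by linarith
  have hA : a ^ p = a ^ (p - 1) * a := by
    rw [← Real.rpow_add_one ha0.ne']; congr 1; ring
  have hB : b ^ p ≤ a ^ (p - 1) * b := by
    rcases hb.eq_or_lt with h0 | h0
    · rw [← h0, Real.zero_rpow (by linarith)]; simp
    · have : b ^ p = b ^ (p - 1) * b := by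
        rw [← Real.rpow_add_one h0.ne']; congr 1; ring
      rw [this]
      exact mul_le_mul_of_nonneg_right (Real.rpow_le_rpow hb hba (by linarith)) hb
  have h2 : (1 / 2 : ℝ) ^ (p - 1) ≤ a ^ (p - 1) :=
    Real.rpow_le_rpow (by norm_num) ha (by linarith)
  have h3 := mul_le_mul_of_nonneg_right h2 (sub_nonneg.2 hba)
  rw [hA]; nlinarith

theorem sup_two_sided_bound
    (p lam lam' h h' gam gam' C C' d : ℝ)
    (hp : 1 < p) (hlam : 1 ≤ lam) (hlam' : 1 ≤ lam')
    (vl vl' : ℝ → ℝ)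
    (hprof : IsTWProfile p lam vl) (hprof' : IsTWProfile p lam' vl')
    (hasym : HasExpAsym p lam gam C vl) (hasym' : HasExpAsym p lam' gam' C' vl')
    (hd : d = (gam * gam' + (p - 1)) / p)
    (v : ℝ → ℝ → ℝ)
    (hv : ∀ x τ, v x τ = min (vl (x - lam * τ + h)) (vl' (-x - lam' * τ + h')))
    (τ₀ D : ℝ) (hD : 0 < D)
    (u : ℝ → ℝ → ℝ)
    (hbound : ∀ x τ, τ ≤ τ₀ → 0 ≤ u x τ ∧ u x τ ≤ v x τ)
    (hint : ∀ τ ≤ τ₀, Integrable (fun x => v x τ ^ p - u x τ ^ p))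
    (hest : ∀ τ ≤ τ₀, (∫ x, (v x τ ^ p - u x τ ^ p)) ≤ D * Real.exp (d * τ)) :
    ∃ Dbar Cbar : ℝ, 0 < Cbar ∧ Cbar ≤ Dbar ∧ ∃ τ₁ ≤ τ₀, ∀ τ ≤ τ₁,
      1 - Dbar * Real.exp (d * τ) ≤ (⨆ x, u x τ) ∧
      (⨆ x, u x τ) ≤ 1 - Cbar * Real.exp (d * τ) := by
  obtain ⟨X, hX⟩ := asym_bounds hasym
  obtain ⟨X', hX'⟩ := asym_bounds hasym'
  have hm := prof_mono hprof
  have hm' := prof_mono hprof'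
  have hv1 := hprof.2.2.1
  obtain ⟨hg, hC, hq, _⟩ := hasym
  obtain ⟨hg', hC', hq', _⟩ := hasym'
  have hp0 : 0 < p := by linarith
  have hdpos : 0 < d := by
    rw [hd]; have := mul_pos hg hg'; apply div_pos <;> linarith
  -- the center of the crossing
  obtain ⟨a, ha1, ha2⟩ : ∃ a, gam * (lam - a) = d ∧ gam' * (lam' + a) = d := by
    refine ⟨lam - d / gam, by field_simp; ring, ?_⟩
    have e1 : lam = (gam ^ 2 + (p - 1)) / (p * gam) := by
      rw [eq_div_iff (by positivity)]; linarith
    have e2 : lam' = (gam' ^ 2 + (p - 1)) / (p * gam') := by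
      rw [eq_div_iff (by positivity)]; linarith
    rw [e1, e2, hd]; field_simp; ring
  have hla : 0 < lam - a := by
    by_contra hc; push Not at hc
    nlinarith [mul_nonneg hg.le (sub_nonneg.2 hc)]
  have hla' : 0 < lam' + a := by
    by_contra hc; push Not at hc
    nlinarith [mul_nonneg hg'.le (sub_nonneg.2 hc)]
  set K := max (2 * C * Real.exp (-(gam * h))) (2 * C' * Real.exp (-(gam' * (h' - 1)))) with hK
  set c := min (C / 2 * Real.exp (-(gam * h))) (C' / 2 * Real.exp (-(gam' * h'))) with hc
  have hcpos : 0 < c := by rw [hc]; apply lt_min <;> positivity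
  have hKpos : 0 < K := lt_max_of_lt_left (by positivity)
  set q := (1 / 2 : ℝ) ^ (p - 1) with hqdef
  have hqpos : 0 < q := by rw [hqdef]; positivity
  have hDq : 0 < D / q := div_pos hD hqpos
  have T1 : ∀ᶠ τ : ℝ in atBot, X ≤ (a * τ - lam * τ + h) := by
    filter_upwards [eventually_le_atBot ((h - X) / (lam - a))] with τ hτ
    rw [le_div_iff₀ hla] at hτ; nlinarith
  have T2 : ∀ᶠ τ : ℝ in atBot, X' ≤ (-(a * τ + 1) - lam' * τ + h') := by
    filter_upwards [eventually_le_atBot ((h' - 1 - X') / (lam' + a))] with τ hτ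
    rw [le_div_iff₀ hla'] at hτ; nlinarith
  have T3 : ∀ᶠ τ : ℝ in atBot, K * Real.exp (d * τ) ≤ 1 / 2 := by
    have : Tendsto (fun τ : ℝ => K * Real.exp (d * τ)) atBot (𝓝 (K * 0)) :=
      (Real.tendsto_exp_atBot.comp (tendsto_id.const_mul_atBot hdpos)).const_mul K
    rw [mul_zero] at this
    exact (this.eventually (gt_mem_nhds (by norm_num : (0:ℝ) < 1 / 2))).mono fun _ h => h.le
  obtain ⟨T, hT⟩ := eventually_atBot.1 (T1.and (T2.and T3))
  refine ⟨max c (K + D / q + 1), c, hcpos, le_max_left _ _, min T τ₀, min_le_right _ _, ?_⟩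
  intro τ hτ
  obtain ⟨t1, t2, t3⟩ := hT τ (hτ.trans (min_le_left _ _))
  have hτ0 : τ ≤ τ₀ := hτ.trans (min_le_right _ _)
  set E := Real.exp (d * τ) with hE
  have hEpos : 0 < E := Real.exp_pos _
  have E1 : Real.exp (-(gam * (a * τ - lam * τ + h))) = Real.exp (-(gam * h)) * E := by
    rw [hE, ← Real.exp_add, ← ha1]; congr 1; ring
  have E2 : Real.exp (-(gam' * (-(a * τ) - lam' * τ + h'))) = Real.exp (-(gam' * h')) * E := by
    rw [hE, ← Real.exp_add, ← ha2]; congr 1; ring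
  have E3 : Real.exp (-(gam' * (-(a * τ + 1) - lam' * τ + h')))
      = Real.exp (-(gam' * (h' - 1))) * E := by
    rw [hE, ← Real.exp_add, ← ha2]; congr 1; ring
  have hupper : ∀ x, u x τ ≤ 1 - c * E := by
    intro x
    have hu := (hbound x τ hτ0).2
    rw [hv] at hu
    rcases le_total x (a * τ) with hx | hx
    · have h1 := hu.trans (min_le_left _ _)
      have h2 := hm (show x - lam * τ + h ≤ a * τ - lam * τ + h by linarith)
      have h3 := (hX _ t1).1
      rw [E1, ← mul_assoc] at h3
      have h4 := mul_le_mul_of_nonneg_right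
        (min_le_left (C / 2 * Real.exp (-(gam * h))) (C' / 2 * Real.exp (-(gam' * h')))) hEpos.le
      rw [← hc] at h4
      linarith
    · have h1 := hu.trans (min_le_right _ _)
      have h2 := hm' (show -x - lam' * τ + h' ≤ -(a * τ) - lam' * τ + h' by linarith)
      have h3 := (hX' (-(a * τ) - lam' * τ + h') (by linarith)).1
      rw [E2, ← mul_assoc] at h3
      have h4 := mul_le_mul_of_nonneg_right
        (min_le_right (C / 2 * Real.exp (-(gam * h))) (C' / 2 * Real.exp (-(gam' * h')))) hEpos.le
      rw [← hc] at h4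
      linarith
  refine ⟨?_, ciSup_le hupper⟩
  by_contra hcon
  push Not at hcon
  have hbdd : BddAbove (Set.range fun x => u x τ) := ⟨_, by rintro _ ⟨x, rfl⟩; exact hupper x⟩
  have hule : ∀ x, u x τ ≤ 1 - (K + D / q + 1) * E := by
    intro x
    have h1 := le_ciSup hbdd x
    have h2 := mul_le_mul_of_nonneg_right (le_max_right c (K + D / q + 1)) hEpos.le
    linarith
  have hvge : ∀ x ∈ Set.Icc (a * τ) (a * τ + 1), 1 - K * E ≤ v x τ := by
    rintro x ⟨hx1, hx2⟩
    rw [hv]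
    apply le_min
    · have h2 := hm (show a * τ - lam * τ + h ≤ x - lam * τ + h by linarith)
      have h3 := (hX _ t1).2
      rw [E1, ← mul_assoc] at h3
      have h4 := mul_le_mul_of_nonneg_right
        (le_max_left (2 * C * Real.exp (-(gam * h))) (2 * C' * Real.exp (-(gam' * (h' - 1))))) hEpos.le
      rw [← hK] at h4
      linarith
    · have h2 := hm' (show -(a * τ + 1) - lam' * τ + h' ≤ -x - lam' * τ + h' by linarith)
      have h3 := (hX' _ t2).2
      rw [E3, ← mul_assoc] at h3
      have h4 := mul_le_mul_of_nonneg_right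
        (le_max_right (2 * C * Real.exp (-(gam * h))) (2 * C' * Real.exp (-(gam' * (h' - 1))))) hEpos.le
      rw [← hK] at h4
      linarith
  have hlow : ∀ x ∈ Set.Icc (a * τ) (a * τ + 1), (D + q) * E ≤ v x τ ^ p - u x τ ^ p := by
    intro x hx
    have h1 := hvge x hx
    have h2 := pow_diff_lower hp (hbound x τ hτ0).1 (hbound x τ hτ0).2 (by linarith)
    rw [← hqdef] at h2
    have h3 : (D / q + 1) * E ≤ v x τ - u x τ := by linarith [hule x]
    have h4 := mul_le_mul_of_nonneg_left h3 hqpos.le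
    have h5 : q * ((D / q + 1) * E) = (D + q) * E := by field_simp
    linarith
  have hI := hint τ hτ0
  have hnn : ∀ x, 0 ≤ v x τ ^ p - u x τ ^ p := fun x =>
    sub_nonneg.2 (Real.rpow_le_rpow (hbound x τ hτ0).1 (hbound x τ hτ0).2 hp0.le)
  have i1 : ∫ x in Set.Icc (a * τ) (a * τ + 1), (v x τ ^ p - u x τ ^ p)
      ≤ ∫ x, (v x τ ^ p - u x τ ^ p) :=
    setIntegral_le_integral hI (Eventually.of_forall hnn)
  have i2 : ∫ _x in Set.Icc (a * τ) (a * τ + 1), (D + q) * E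
      ≤ ∫ x in Set.Icc (a * τ) (a * τ + 1), (v x τ ^ p - u x τ ^ p) :=
    setIntegral_mono_on continuous_const.integrableOn_Icc hI.integrableOn measurableSet_Icc hlow
  rw [setIntegral_const] at i2
  simp at i2
  have := hest τ hτ0
  nlinarith [mul_pos hqpos hEpos]
end

section
/- In the merged traveling-wave configuration, let x(τ) denote the unique point with v_λ(x(τ) + h − λτ) = v_{λ'}(−x(τ) + h' − λ'τ), and let x̄(τ) denote the unique point with v_λ(x̄(τ) − λτ) = v_{λ'}(−x̄(τ) − λ'τ). Then lim_{τ→−∞} ( x̄(τ) − x(τ) ) = (h γ_λ − h' γ_{λ'})/(γ_λ + γ_{λ'}). -/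
open Real Filter Topology MeasureTheory

theorem aux_strictMono {v : ℝ → ℝ} {p lam : ℝ} (hv : IsTWProfile p lam v) : StrictMono v :=
  strictMono_of_deriv_pos hv.2.2.2.1

theorem aux_lt_one {v : ℝ → ℝ} {p lam : ℝ} (hv : IsTWProfile p lam v) (x : ℝ) : v x < 1 :=
  lt_of_lt_of_le (aux_strictMono hv (by linarith : x < x + 1)) (hv.2.2.1 (x + 1))

theorem aux_log {v : ℝ → ℝ} {p lam gam C : ℝ} (hv : IsTWProfile p lam v)
    (ha : HasExpAsym p lam gam C v) :
    Tendsto (fun x => gam * x + Real.log (1 - v x)) atTop (𝓝 (Real.log C)) := by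
  refine (ha.2.2.2.log ha.2.1.ne').congr fun x => ?_
  have := aux_lt_one hv x
  rw [Real.log_mul (Real.exp_pos _).ne' (by linarith), Real.log_exp]

theorem aux_both {v w : ℝ → ℝ} {p lam lam' : ℝ} (hv : IsTWProfile p lam v)
    (hw : IsTWProfile p lam' w) {A B : ℝ → ℝ} (hAB : ∀ t, v (A t) = w (B t))
    (hsum : Tendsto (fun t => A t + B t) atBot atTop) :
    Tendsto A atBot atTop ∧ Tendsto B atBot atTop := by
  have key : ∀ M : ℝ, ∀ᶠ t in atBot, M < A t ∧ M < B t := by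
    intro M
    have hm : max (v M) (w M) < 1 := max_lt (aux_lt_one hv M) (aux_lt_one hw M)
    obtain ⟨N, hN1, hN2⟩ := ((hv.2.2.2.2.2.2.eventually (lt_mem_nhds hm)).and
      (hw.2.2.2.2.2.2.eventually (lt_mem_nhds hm))).exists
    filter_upwards [hsum.eventually_ge_atTop (2 * N)] with t ht
    have hval : max (v M) (w M) < v (A t) := by
      rcases le_total N (A t) with h1 | h1
      · exact hN1.trans_le ((aux_strictMono hv).monotone h1)
      · rw [hAB]
        exact hN2.trans_le ((aux_strictMono hw).monotone (by linarith))
    refine ⟨(aux_strictMono hv).lt_iff_lt.1 ((le_max_left _ _).trans_lt hval),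
      (aux_strictMono hw).lt_iff_lt.1 ?_⟩
    rw [← hAB]
    exact (le_max_right _ _).trans_lt hval
  exact ⟨tendsto_atTop.2 fun M => (key M).mono fun t ht => ht.1.le,
    tendsto_atTop.2 fun M => (key M).mono fun t ht => ht.2.le⟩

theorem aux_main {v w : ℝ → ℝ} {p lam lam' gam gam' C C' : ℝ} (hv : IsTWProfile p lam v)
    (hw : IsTWProfile p lam' w) (ha : HasExpAsym p lam gam C v)
    (ha' : HasExpAsym p lam' gam' C' w) {A B : ℝ → ℝ} (hAB : ∀ t, v (A t) = w (B t))
    (hsum : Tendsto (fun t => A t + B t) atBot atTop) :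
    Tendsto (fun t => gam * A t - gam' * B t) atBot (𝓝 (Real.log C - Real.log C')) := by
  obtain ⟨hA, hB⟩ := aux_both hv hw hAB hsum
  refine (((aux_log hv ha).comp hA).sub ((aux_log hw ha').comp hB)).congr fun t => ?_
  simp only [Function.comp, hAB]
  ring

theorem aux_lin (c d : ℝ) (hd : 0 < d) : Tendsto (fun t : ℝ => c - d * t) atBot atTop := by
  have h1 : Tendsto (fun t : ℝ => (-d) * t) atBot atTop :=
    tendsto_id.const_mul_atBot_of_neg (by linarith)
  refine (tendsto_atTop_add_const_left _ c h1).congr fun t => ?_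
  ring

theorem intersection_points_difference_limit
    (p lam lam' h h' gam gam' C C' : ℝ)
    (hp : 1 < p) (hlam : 1 ≤ lam) (hlam' : 1 ≤ lam')
    (vl vl' : ℝ → ℝ)
    (hprof : IsTWProfile p lam vl) (hprof' : IsTWProfile p lam' vl')
    (hasym : HasExpAsym p lam gam C vl) (hasym' : HasExpAsym p lam' gam' C' vl')
    (X Xbar : ℝ → ℝ)
    (hX : ∀ τ, vl (X τ + h - lam * τ) = vl' (-(X τ) + h' - lam' * τ))
    (hXbar : ∀ τ, vl (Xbar τ - lam * τ) = vl' (-(Xbar τ) - lam' * τ)) :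
    Tendsto (fun τ => Xbar τ - X τ) atBot
      (𝓝 ((h * gam - h' * gam') / (gam + gam'))) := by
  have hd : 0 < lam + lam' := by linarith
  have h1 := aux_main hprof hprof' hasym hasym' hX
    ((aux_lin (h + h') _ hd).congr fun t => by ring)
  have h2 := aux_main hprof hprof' hasym hasym' hXbar
    ((aux_lin 0 _ hd).congr fun t => by ring)
  have hg : gam + gam' ≠ 0 := (add_pos hasym.1 hasym'.1).ne'
  have h3 := ((h2.sub h1).add_const (h * gam - h' * gam')).div_const (gam + gam')
  rw [sub_self, zero_add] at h3
  refine h3.congr fun t => ?_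
  rw [div_eq_iff hg]
  ring
end
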